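/- For any p-dimensional vectors X_{i1},…,X_{in_i} and X_{j1},…,X_{jn_j} with n_i, n_j ≥ 3, the following algebraic identity holds: (1/((n_i)_3 (n_j)_3)) Σ_{k_1,k_2,k_3 distinct; k_4,k_5,k_6 distinct} (X_{ik_1}−X_{ik_2})'(X_{jk_4}−X_{jk_5})(X_{jk_4}−X_{jk_6})'(X_{ik_1}−X_{ik_3}) = tr(S_i S_j), where S_i and S_j are the sample covariance matrices of the two samples. -/

import Mathlib

open MeasureTheory ProbabilityTheory Filter Matrix Finset Asymptotics Topology

noncomputable section

/-- sample mean of the first `n` vectors of `X`. -/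
def sMean (p n : ℕ) (X : ℕ → Fin p → ℝ) : Fin p → ℝ :=
  fun a => (n : ℝ)⁻¹ * ∑ j ∈ Finset.range n, X j a

/-- sample covariance matrix of the first `n` vectors of `X`. -/
def sCov (p n : ℕ) (X : ℕ → Fin p → ℝ) : Matrix (Fin p) (Fin p) ℝ :=
  Matrix.of fun a b => ((n : ℝ) - 1)⁻¹ *
    ∑ j ∈ Finset.range n, (X j a - sMean p n X a) * (X j b - sMean p n X b)

/-- the statistic `T_n^(k)`. -/
def Tstat (p k : ℕ) (nn : Fin k → ℕ) (X : Fin k → ℕ → Fin p → ℝ) : ℝ :=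
  (∑ i : Fin k, ∑ j : Fin k, if i < j then
      (sMean p (nn i) (X i) - sMean p (nn j) (X j)) ⬝ᵥ
        (sMean p (nn i) (X i) - sMean p (nn j) (X j))
    else 0)
  - ((k : ℝ) - 1) * ∑ i : Fin k, ((nn i : ℝ))⁻¹ * (sCov p (nn i) (X i)).trace


/-- the unbiased nonparametric estimator (UNE) of `tr(Σ_iΣ_j)`:
`(1/((n_i)_3 (n_j)_3)) Σ (X_{k1}−X_{k2})'(Y_{k4}−Y_{k5})(Y_{k4}−Y_{k6})'(X_{k1}−X_{k3})`. -/
def uneCross (p ni nj : ℕ) (X Y : ℕ → Fin p → ℝ) : ℝ :=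
  ((ni.descFactorial 3 : ℝ) * (nj.descFactorial 3 : ℝ))⁻¹ *
    ∑ a ∈ Finset.univ.filter (fun a : Fin 3 → Fin ni => ∀ s t, s ≠ t → a s ≠ a t),
      ∑ b ∈ Finset.univ.filter (fun b : Fin 3 → Fin nj => ∀ s t, s ≠ t → b s ≠ b t),
        ((X ↑(a 0) - X ↑(a 1)) ⬝ᵥ (Y ↑(b 0) - Y ↑(b 1))) *
          ((Y ↑(b 0) - Y ↑(b 2)) ⬝ᵥ (X ↑(a 0) - X ↑(a 2)))

/-- A sum over functions on `Fin 3` is an iterated triple sum. -/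
theorem sum_fin_three_arrow {α M : Type*} [Fintype α] [AddCommMonoid M] (F : α → α → α → M) :
    ∑ a : Fin 3 → α, F (a 0) (a 1) (a 2) = ∑ i, ∑ j, ∑ k, F i j k := by
  let e : (Fin 3 → α) ≃ α × α × α :=
    { toFun := fun a => (a 0, a 1, a 2)
      invFun := fun t => ![t.1, t.2.1, t.2.2]
      left_inv := fun a => by ext s; fin_cases s <;> rfl
      right_inv := fun _ => rfl }
  rw [Fintype.sum_equiv e (fun a => F (a 0) (a 1) (a 2)) (fun t => F t.1 t.2.1 t.2.2)
    (fun _ => rfl), Fintype.sum_prod_type]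
  simp only [Fintype.sum_prod_type]

/-- The distinct-triple sum of products of differences of two centred families. -/
theorem sum_distinct_sub_mul_sub {α : Type*} [Fintype α] [DecidableEq α] (u v : α → ℝ)
    (hu : ∑ i, u i = 0) (hv : ∑ i, v i = 0) :
    ∑ a ∈ univ.filter (fun a : Fin 3 → α => ∀ s t, s ≠ t → a s ≠ a t),
        (u (a 0) - u (a 1)) * (v (a 0) - v (a 2)) =
      (Fintype.card α : ℝ) * ((Fintype.card α : ℝ) - 2) * ∑ i, u i * v i := by
  have key : ∀ a : Fin 3 → α,
      (if ∀ s t, s ≠ t → a s ≠ a t then (u (a 0) - u (a 1)) * (v (a 0) - v (a 2)) else 0) =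
        (u (a 0) - u (a 1)) * (v (a 0) - v (a 2)) -
          if a 1 = a 2 then (u (a 0) - u (a 1)) * (v (a 0) - v (a 2)) else 0 := by
    intro a
    by_cases h01 : a 0 = a 1
    · simp [h01]
    by_cases h02 : a 0 = a 2
    · simp [h02]
    by_cases h12 : a 1 = a 2
    · rw [if_neg (fun h => h 1 2 (by decide) h12), if_pos h12, sub_self]
    · rw [if_pos, if_neg h12, sub_zero]
      simp [Fin.forall_fin_succ, h01, h02, h12, Ne.symm h01, Ne.symm h02, Ne.symm h12]
  have hall : ∀ i, ∑ j, ∑ k, (u i - u j) * (v i - v k) =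
      (Fintype.card α : ℝ) ^ 2 * (u i * v i) := by
    intro i
    rw [← Finset.sum_mul_sum, sum_sub_distrib, sum_sub_distrib, hu, hv]
    simp
    ring
  have hdiag : ∀ i, ∑ j, (u i - u j) * (v i - v j) =
      (Fintype.card α : ℝ) * (u i * v i) + ∑ j, u j * v j := by
    intro i
    have : ∀ j, (u i - u j) * (v i - v j) = u i * v i - u i * v j - u j * v i + u j * v j :=
      fun j => by ring
    simp only [this, sum_add_distrib, sum_sub_distrib, ← mul_sum, ← sum_mul, hu, hv]
    simp
    ring
  rw [sum_filter, sum_congr rfl fun a _ => key a, sum_sub_distrib,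
    sum_fin_three_arrow fun i j k => (u i - u j) * (v i - v k),
    sum_fin_three_arrow fun i j k => if j = k then (u i - u j) * (v i - v k) else 0]
  rw [sum_congr rfl fun i _ => hall i]
  simp only [sum_ite_eq, mem_univ, if_true, hdiag, sum_add_distrib, ← mul_sum]
  simp
  ring

theorem sum_sub_sMean (p n : ℕ) (hn : n ≠ 0) (X : ℕ → Fin p → ℝ) (c : Fin p) :
    ∑ i : Fin n, (X i c - sMean p n X c) = 0 := by
  have : (n : ℝ) ≠ 0 := Nat.cast_ne_zero.mpr hn
  rw [Fin.sum_univ_eq_sum_range fun i => X i c - sMean p n X c, sum_sub_distrib]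
  simp [sMean, this]

/-- The entries of the sample covariance matrix are third-order `U`-statistics. -/
theorem sum_distinct_eq_sCov (p n : ℕ) (hn : 3 ≤ n) (X : ℕ → Fin p → ℝ) (c d : Fin p) :
    ∑ a ∈ univ.filter (fun a : Fin 3 → Fin n => ∀ s t, s ≠ t → a s ≠ a t),
        (X (a 0) c - X (a 1) c) * (X (a 0) d - X (a 2) d) =
      (n.descFactorial 3 : ℝ) * sCov p n X c d := by
  have h := sum_distinct_sub_mul_sub _ _ (sum_sub_sMean p n (by omega) X c)
    (sum_sub_sMean p n (by omega) X d)
  simp only [sub_sub_sub_cancel_right, Fintype.card_fin] at h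
  rw [h, Fin.sum_univ_eq_sum_range fun i => (X i c - sMean p n X c) * (X i d - sMean p n X d)]
  have h1 : (n : ℝ) - 1 ≠ 0 := by
    have : (3 : ℝ) ≤ n := by exact_mod_cast hn
    linarith
  have hdf : (n.descFactorial 3 : ℝ) = n * (n - 1) * (n - 2) := by
    simp only [Nat.descFactorial, Nat.sub_zero, Nat.cast_mul, Nat.cast_sub (show 1 ≤ n by omega),
      Nat.cast_sub (show 2 ≤ n by omega)]
    push_cast
    ring
  rw [hdf, sCov, Matrix.of_apply]
  field_simp

theorem sum_sum_comm_sum_sum {α β γ δ M : Type*} [AddCommMonoid M] (s : Finset α) (t : Finset β)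
    (u : Finset γ) (v : Finset δ) (F : α → β → γ → δ → M) :
    ∑ a ∈ s, ∑ b ∈ t, ∑ c ∈ u, ∑ d ∈ v, F a b c d =
      ∑ c ∈ u, ∑ d ∈ v, ∑ a ∈ s, ∑ b ∈ t, F a b c d := by
  have h := sum_comm (s := s ×ˢ t) (t := u ×ˢ v) (f := fun x y => F x.1 x.2 y.1 y.2)
  simpa only [sum_product] using h

theorem sCov_apply_comm (p n : ℕ) (X : ℕ → Fin p → ℝ) (c d : Fin p) :
    sCov p n X c d = sCov p n X d c := by
  simp only [sCov, Matrix.of_apply, mul_comm]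

/-- For any `p`-dimensional vectors `X_{i1},…,X_{in_i}` and `X_{j1},…,X_{jn_j}` with
`n_i, n_j ≥ 3`, the `U`-statistic `\hat{tr(Σ_iΣ_j)}` equals `tr(S_i S_j)`. -/
theorem statement10
    (p ni nj : ℕ) (hni : 3 ≤ ni) (hnj : 3 ≤ nj)
    (X : ℕ → Fin p → ℝ) (Y : ℕ → Fin p → ℝ) :
    uneCross p ni nj X Y = (sCov p ni X * sCov p nj Y).trace := by
  have hdf : ∀ n, 3 ≤ n → (n.descFactorial 3 : ℝ) ≠ 0 := fun n hn => by
    exact_mod_cast (Nat.descFactorial_pos.mpr hn).ne'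
  have hterm : ∀ (a : Fin 3 → Fin ni) (b : Fin 3 → Fin nj),
      ((X (a 0) - X (a 1)) ⬝ᵥ (Y (b 0) - Y (b 1))) * ((Y (b 0) - Y (b 2)) ⬝ᵥ (X (a 0) - X (a 2))) =
        ∑ c, ∑ d, ((X (a 0) c - X (a 1) c) * (X (a 0) d - X (a 2) d)) *
          ((Y (b 0) c - Y (b 1) c) * (Y (b 0) d - Y (b 2) d)) := fun a b => by
    simp only [dotProduct, sum_mul_sum, Pi.sub_apply]
    exact sum_congr rfl fun c _ => sum_congr rfl fun d _ => by ring
  rw [uneCross, inv_mul_eq_iff_eq_mul₀ (mul_ne_zero (hdf ni hni) (hdf nj hnj))]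
  simp only [hterm, Matrix.trace, Matrix.diag_apply, Matrix.mul_apply, mul_sum]
  rw [sum_sum_comm_sum_sum]
  refine sum_congr rfl fun c _ => sum_congr rfl fun d _ => ?_
  rw [← sum_mul_sum, sum_distinct_eq_sCov p ni hni, sum_distinct_eq_sCov p nj hnj,
    sCov_apply_comm p nj Y c d]
  ring
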